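/- For the Dining Cryptographers distribution with secret coin bias q, the restrictive probabilistic symmetric opacity of the predicate 'cryptographer 2 paid' with respect to cryptographer 1's observation equals RPSO(μ,φ,𝒪) = −1 / log₂(min(q, 1−q)); in particular it equals 1 exactly when q = 1/2 and tends to 0 as q tends to 0 or 1. (Section 4.2 of the paper.) -/

import Mathlib

open scoped ENNReal Classical

/-- The probability of a set of runs under a PMF. -/
noncomputable def mOf {R : Type*} (μ : PMF R) (S : Set R) : ℝ≥0∞ :=
  ∑' ρ : S, μ ρ

/-- Liberal probabilistic opacity. -/
noncomputable def LPO {R Obs : Type*} (μ : PMF R) (φ : Set R) (O : R → Obs) : ℝ≥0∞ :=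
  ∑' o : Obs, if O ⁻¹' {o} ⊆ φ then mOf μ (O ⁻¹' {o}) else 0

/-- Liberal probabilistic symmetrical opacity. -/
noncomputable def LPSO {R Obs : Type*} (μ : PMF R) (φ : Set R) (O : R → Obs) : ℝ≥0∞ :=
  LPO μ φ O + LPO μ φᶜ O

/-- Restrictive probabilistic opacity. -/
noncomputable def RPO {R Obs : Type*} (μ : PMF R) (φ : Set R) (O : R → Obs) : ℝ≥0∞ :=
  (∑' o : Obs, (mOf μ (O ⁻¹' {o})) ^ 2 / mOf μ (φᶜ ∩ O ⁻¹' {o}))⁻¹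

/-- Vulnerability of φ within the observation class of o. -/
noncomputable def Vul {R Obs : Type*} (μ : PMF R) (φ : Set R) (O : R → Obs) (o : Obs) : ℝ≥0∞ :=
  max (mOf μ (φ ∩ O ⁻¹' {o})) (mOf μ (φᶜ ∩ O ⁻¹' {o})) / mOf μ (O ⁻¹' {o})

/-- Restrictive probabilistic symmetric opacity. -/
noncomputable def RPSO {R Obs : Type*} (μ : PMF R) (φ : Set R) (O : R → Obs) : ℝ≥0∞ :=
  (∑' o : Obs, mOf μ (O ⁻¹' {o}) *
    (if Vul μ φ O o = 1 then ⊤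
     else ENNReal.ofReal (- Real.logb 2 ((1 - Vul μ φ O o).toReal))))⁻¹

/-- φ is opaque for the observation O. -/
def IsOpaque {R Obs : Type*} (φ : Set R) (O : R → Obs) : Prop :=
  ∀ o : Obs, ¬ O ⁻¹' {o} ⊆ φ

/-- φ is symmetrically opaque for the observation O. -/
def IsSymOpaque {R Obs : Type*} (φ : Set R) (O : R → Obs) : Prop :=
  ∀ o : Obs, ¬ O ⁻¹' {o} ⊆ φ ∧ ¬ O ⁻¹' {o} ⊆ φᶜ

/-- Cryptographer 1's observation in the Dining Cryptographers protocol: from a run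
(f₁₂, f₁₃, f₂₃, pay₂) he sees his own coins f₁₂, f₁₃ and the announced bits
r₂ = f₁₂ xor f₂₃ xor pay₂ and r₃ = f₁₃ xor f₂₃ xor (¬pay₂). -/
def dcAnnounce : Bool × Bool × Bool × Bool → Bool × Bool × Bool × Bool :=
  fun x => match x with
  | (f12, f13, f23, pay2) =>
      (f12, f13, Bool.xor f12 (Bool.xor f23 pay2), Bool.xor f13 (Bool.xor f23 (!pay2)))

/-- The probability of a set splits over a predicate and its complement. -/
lemma mOf_inter_add_mOf_compl_inter {R : Type*} (μ : PMF R) (φ S : Set R) :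
    mOf μ (φ ∩ S) + mOf μ (φᶜ ∩ S) = mOf μ S := by
  simp only [mOf, tsum_subtype]
  rw [← ENNReal.tsum_add]
  refine tsum_congr fun x => ?_
  by_cases hφ : x ∈ φ <;> by_cases hS : x ∈ S <;> simp [hφ, hS]

/-- The observation classes have total probability one. -/
lemma tsum_mOf_fiber {R Obs : Type*} (μ : PMF R) (O : R → Obs) :
    ∑' o : Obs, mOf μ (O ⁻¹' {o}) = 1 := by
  rw [← μ.tsum_coe, ← (Equiv.sigmaFiberEquiv O).tsum_eq, ENNReal.tsum_sigma']
  rfl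

/-- If every observation class has the same vulnerability `v ≠ 1`, the restrictive probabilistic
symmetric opacity is `(-log₂ (1 - v))⁻¹`. -/
lemma RPSO_eq_of_forall_Vul_eq {R Obs : Type*} (μ : PMF R) (φ : Set R) (O : R → Obs)
    {v : ℝ≥0∞} (hv : v ≠ 1) (h : ∀ o, Vul μ φ O o = v) :
    RPSO μ φ O = (ENNReal.ofReal (-Real.logb 2 (1 - v).toReal))⁻¹ := by
  simp only [RPSO, h, if_neg hv]
  rw [ENNReal.tsum_mul_right, tsum_mOf_fiber, one_mul]

/-- In each observation class exactly one run has cryptographer 2 paying and exactly one does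
not, and these two runs carry opposite secret coins. -/
lemma exists_dcAnnounce_fiber (o : Set.range dcAnnounce) :
    ∃ f12 f13 f23 : Bool,
      {x : Bool × Bool × Bool × Bool | x.2.2.2 = true} ∩
          Set.rangeFactorization dcAnnounce ⁻¹' {o} = {(f12, f13, f23, true)} ∧
      {x : Bool × Bool × Bool × Bool | x.2.2.2 = true}ᶜ ∩
          Set.rangeFactorization dcAnnounce ⁻¹' {o} = {(f12, f13, !f23, false)} := by
  obtain ⟨_, ⟨⟨f12, f13, f23, p⟩, rfl⟩⟩ := o
  refine ⟨f12, f13, Bool.xor f23 (!p), ?_, ?_⟩ <;>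
  · ext ⟨a, b, c, d⟩
    simp only [Set.mem_inter_iff, Set.mem_compl_iff, Set.mem_ofPred_eq, Set.mem_preimage,
      Set.mem_singleton_iff, Subtype.ext_iff, Set.rangeFactorization_coe, dcAnnounce,
      Prod.mk.injEq]
    revert f12 f13 f23 p a b c d
    decide

lemma Vul_dcAnnounce {q : ℝ} (hq0 : 0 < q) (hq1 : q < 1)
    {μ : PMF (Bool × Bool × Bool × Bool)}
    (hμ : ∀ f12 f13 f23 pay2 : Bool,
      μ (f12, f13, f23, pay2) =
        ENNReal.ofReal ((1 / 8) * (if f23 then q else 1 - q)))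
    (o : Set.range dcAnnounce) :
    Vul μ {x : Bool × Bool × Bool × Bool | x.2.2.2 = true}
      (Set.rangeFactorization dcAnnounce) o = ENNReal.ofReal (max q (1 - q)) := by
  obtain ⟨f12, f13, f23, h₁, h₂⟩ := exists_dcAnnounce_fiber o
  have hsingle (a : Bool × Bool × Bool × Bool) : mOf μ {a} = μ a := tsum_singleton a μ
  rw [Vul, ← mOf_inter_add_mOf_compl_inter μ {x | x.2.2.2 = true}
    (Set.rangeFactorization dcAnnounce ⁻¹' {o}), h₁, h₂, hsingle, hsingle,
    hμ, hμ, ← ENNReal.ofReal_max, ← ENNReal.ofReal_add, ← ENNReal.ofReal_div_of_pos]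
  · congr 1
    rw [← mul_max_of_nonneg _ _ (by norm_num : (0 : ℝ) ≤ 1 / 8)]
    cases f23 <;> simp [max_comm] <;> ring
  all_goals cases f23 <;> simp <;> linarith

lemma RPSO_dcAnnounce {q : ℝ} (hq0 : 0 < q) (hq1 : q < 1)
    {μ : PMF (Bool × Bool × Bool × Bool)}
    (hμ : ∀ f12 f13 f23 pay2 : Bool,
      μ (f12, f13, f23, pay2) =
        ENNReal.ofReal ((1 / 8) * (if f23 then q else 1 - q))) :
    RPSO μ {x : Bool × Bool × Bool × Bool | x.2.2.2 = true}
        (Set.rangeFactorization dcAnnounce) =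
      ENNReal.ofReal (-1 / Real.logb 2 (min q (1 - q))) := by
  have hmin_pos : 0 < min q (1 - q) := lt_min hq0 (by linarith)
  have hmin_lt : min q (1 - q) < 1 := (min_le_left _ _).trans_lt hq1
  have hmax : 1 - max q (1 - q) = min q (1 - q) := by
    linarith [min_add_max q (1 - q)]
  have hne : ENNReal.ofReal (max q (1 - q)) ≠ 1 := by
    rw [Ne, ENNReal.ofReal_eq_one]
    linarith
  have hlog : 0 < -Real.logb 2 (min q (1 - q)) :=
    neg_pos.2 (Real.logb_neg one_lt_two hmin_pos hmin_lt)
  rw [RPSO_eq_of_forall_Vul_eq μ _ _ hne (Vul_dcAnnounce hq0 hq1 hμ), ← ENNReal.ofReal_one,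
    ← ENNReal.ofReal_sub _ (hq0.le.trans (le_max_left _ _)), hmax,
    ENNReal.toReal_ofReal hmin_pos.le, ← ENNReal.ofReal_inv_of_pos hlog]
  congr 1
  rw [inv_neg, neg_div, one_div]

lemma neg_one_div_logb_min_eq_one_iff {q : ℝ} (hq0 : 0 < q) (hq1 : q < 1) :
    -1 / Real.logb 2 (min q (1 - q)) = 1 ↔ q = 1 / 2 := by
  have hmin_pos : 0 < min q (1 - q) := lt_min hq0 (by linarith)
  have hlog : Real.logb 2 (min q (1 - q)) ≠ 0 :=
    (Real.logb_neg one_lt_two hmin_pos ((min_le_left _ _).trans_lt hq1)).ne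
  rw [div_eq_one_iff_eq hlog, eq_comm, Real.logb_eq_iff_rpow_eq two_pos (by norm_num) hmin_pos,
    Real.rpow_neg_one]
  constructor
  · intro h
    rcases min_choice q (1 - q) with h' | h' <;> linarith
  · rintro rfl
    norm_num

/-- `-1 / log₂ f` tends to zero along any filter on which `f` tends to zero from above. -/
lemma tendsto_neg_one_div_logb {α : Type*} {l : Filter α} {f : α → ℝ}
    (hf : Filter.Tendsto f l (nhdsWithin 0 (Set.Ioi 0))) :
    Filter.Tendsto (fun t => -1 / Real.logb 2 (f t)) l (nhds 0) :=
  tendsto_const_nhds.div_atBot ((Real.tendsto_logb_nhdsGT_zero one_lt_two).comp hf)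


/-- Section 4.2 (Dining Cryptographers): with secret coin bias q, the restrictive
probabilistic symmetric opacity of "cryptographer 2 paid" with respect to
cryptographer 1's observation equals −1/log₂(min(q, 1−q)); in particular it equals 1
exactly when q = 1/2, and the formula tends to 0 as q tends to 0 or to 1. -/
theorem dining_cryptographers_rpso (q : ℝ) (hq0 : 0 < q) (hq1 : q < 1)
    (μ : PMF (Bool × Bool × Bool × Bool))
    (hμ : ∀ f12 f13 f23 pay2 : Bool,
      μ (f12, f13, f23, pay2) =
        ENNReal.ofReal ((1 / 8) * (if f23 then q else 1 - q))) :
    RPSO μ {x : Bool × Bool × Bool × Bool | x.2.2.2 = true}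
        (Set.rangeFactorization dcAnnounce) =
      ENNReal.ofReal (-1 / Real.logb 2 (min q (1 - q))) ∧
    (RPSO μ {x : Bool × Bool × Bool × Bool | x.2.2.2 = true}
        (Set.rangeFactorization dcAnnounce) = 1 ↔ q = 1 / 2) ∧
    Filter.Tendsto (fun t : ℝ => -1 / Real.logb 2 (min t (1 - t)))
      (nhdsWithin 0 (Set.Ioi 0)) (nhds 0) ∧
    Filter.Tendsto (fun t : ℝ => -1 / Real.logb 2 (min t (1 - t)))
      (nhdsWithin 1 (Set.Iio 1)) (nhds 0) := by
  have hmin : Continuous fun t : ℝ => min t (1 - t) := by fun_prop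
  refine ⟨RPSO_dcAnnounce hq0 hq1 hμ, ?_, tendsto_neg_one_div_logb ?_,
    tendsto_neg_one_div_logb ?_⟩
  · rw [RPSO_dcAnnounce hq0 hq1 hμ, ENNReal.ofReal_eq_one,
      neg_one_div_logb_min_eq_one_iff hq0 hq1]
  · refine tendsto_nhdsWithin_iff.2 ⟨?_, ?_⟩
    · simpa using (hmin.tendsto 0).mono_left nhdsWithin_le_nhds
    · filter_upwards [Ioo_mem_nhdsGT (zero_lt_one' ℝ)] with t ht
      exact lt_min ht.1 (sub_pos.2 ht.2)
  · refine tendsto_nhdsWithin_iff.2 ⟨?_, ?_⟩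
    · simpa using (hmin.tendsto 1).mono_left nhdsWithin_le_nhds
    · filter_upwards [Ioo_mem_nhdsLT (zero_lt_one' ℝ)] with t ht
      exact lt_min ht.1 (sub_pos.2 ht.2)
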